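/- arXiv:math/0504044 — 7 statements merged into one kernel-verified Lean document; each statement's English description precedes it below -/
import Mathlib

section
/- Let R₀ > 0, ε ∈ (0,1), n ∈ ℕ, and r ≥ R₀/ε. Let p be a monic polynomial of degree n over ℂ all of whose roots lie in the closed disk {w : |w| ≤ R₀}, let g : ℂ → ℂ be entire, and set f = p·g. Then for every z with |z| ≤ R₀, |g(z)|² ≤ (r^{-2n-1} / (2π(1−ε)^{2n+2})) · ∫₀^{2π} |f(r e^{iθ})|² r dθ. -/
open MeasureTheory

/-- A monic complex polynomial all of whose roots are at distance at least `d` from `w` has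
modulus at least `d ^ natDegree` at `w`. -/
theorem Polynomial.Monic.pow_natDegree_le_norm_eval {p : Polynomial ℂ} (hp : p.Monic) {w : ℂ}
    {d : ℝ} (hd : 0 ≤ d) (h : ∀ a ∈ p.roots, d ≤ ‖w - a‖) :
    d ^ p.natDegree ≤ ‖p.eval w‖ := by
  have hs : p.Splits := IsAlgClosed.splits p
  have key : ∀ s : Multiset ℂ, (∀ a ∈ s, d ≤ ‖w - a‖) →
      d ^ s.card ≤ ‖(s.map fun a ↦ w - a).prod‖ := by
    intro s
    induction s using Multiset.induction_on with
    | empty => simp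
    | cons a s ih =>
      intro hs
      rw [Multiset.card_cons, pow_succ', Multiset.map_cons, Multiset.prod_cons, norm_mul]
      exact mul_le_mul (hs a (Multiset.mem_cons_self a s))
        (ih fun b hb ↦ hs b (Multiset.mem_cons_of_mem hb)) (by positivity) (norm_nonneg _)
  rw [hs.natDegree_eq_card_roots, hs.eval_eq_prod_roots_of_monic hp]
  exact key _ h

theorem cauchy_estimate_on_circle (R₀ ε : ℝ) (hR₀ : 0 < R₀)
    (hε : ε ∈ Set.Ioo (0:ℝ) 1) (n : ℕ) (r : ℝ) (hr : R₀ / ε ≤ r)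
    (p : Polynomial ℂ) (hmonic : p.Monic) (hdeg : p.natDegree = n)
    (hroots : ∀ w ∈ p.roots, ‖w‖ ≤ R₀)
    (g : ℂ → ℂ) (hg : Differentiable ℂ g) :
    ∀ z : ℂ, ‖z‖ ≤ R₀ →
      ‖g z‖ ^ 2 ≤
        (r ^ (2 * n + 1))⁻¹ / (2 * Real.pi * (1 - ε) ^ (2 * n + 2)) *
          ∫ θ in (0:ℝ)..(2 * Real.pi),
            ‖p.eval (r * Complex.exp (θ * Complex.I))
              * g (r * Complex.exp (θ * Complex.I))‖ ^ 2 * r := by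
  intro z hz
  obtain ⟨hε0, hε1⟩ := hε
  have hδ : 0 < 1 - ε := sub_pos.2 hε1
  have hr0 : 0 < r := (div_pos hR₀ hε0).trans_le hr
  have hRr : R₀ ≤ r * ε := (div_le_iff₀ hε0).1 hr
  have hd : 0 < r * (1 - ε) := mul_pos hr0 hδ
  have hdist : ∀ w a : ℂ, ‖w‖ = r → ‖a‖ ≤ R₀ → r * (1 - ε) ≤ ‖w - a‖ := fun w a hw ha ↦ by
    have := norm_sub_norm_le w a
    linarith
  have hz' : z ∈ Metric.ball (0 : ℂ) |r| := by
    rw [mem_ball_zero_iff, abs_of_pos hr0]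
    nlinarith
  have cauchy : Real.circleAverage (fun w ↦ ((w - 0) / (w - z)) • g w ^ 2) 0 r = g z ^ 2 :=
    (hg.pow 2).diffContOnCl.circleAverage_smul_div hz'
  have hcont : Continuous fun θ : ℝ ↦ ‖p.eval (r * Complex.exp (θ * Complex.I))
      * g (r * Complex.exp (θ * Complex.I))‖ ^ 2 * r := by
    have := hg.continuous
    fun_prop
  have pointwise : ∀ w : ℂ, ‖w‖ = r → ‖((w - 0) / (w - z)) • g w ^ 2‖ ≤
      (r ^ (2 * n + 1))⁻¹ / (1 - ε) ^ (2 * n + 2) * (‖p.eval w * g w‖ ^ 2 * r) := fun w hw ↦ by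
    have hp : (r * (1 - ε)) ^ n ≤ ‖p.eval w‖ :=
      hdeg ▸ hmonic.pow_natDegree_le_norm_eval hd.le fun a ha ↦ hdist w a hw (hroots a ha)
    have hkernel : ‖(w - 0) / (w - z)‖ ≤ 1 / (1 - ε) ^ 2 := by
      rw [sub_zero, norm_div, hw, div_le_div_iff₀ (hd.trans_le (hdist w z hw hz)) (by positivity)]
      nlinarith [hdist w z hw hz, mul_pos hd hε0]
    calc ‖((w - 0) / (w - z)) • g w ^ 2‖
        = ‖(w - 0) / (w - z)‖ * ‖g w‖ ^ 2 := by rw [norm_smul, norm_pow]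
      _ ≤ 1 / (1 - ε) ^ 2 * ‖g w‖ ^ 2 := by gcongr
      _ = (r ^ (2 * n + 1))⁻¹ / (1 - ε) ^ (2 * n + 2) *
            (((r * (1 - ε)) ^ n * ‖g w‖) ^ 2 * r) := by
          rw [mul_pow r]
          field_simp
          ring
      _ ≤ (r ^ (2 * n + 1))⁻¹ / (1 - ε) ^ (2 * n + 2) * (‖p.eval w * g w‖ ^ 2 * r) := by
          rw [norm_mul]
          gcongr
  rw [← norm_pow, ← cauchy, Real.circleAverage_def, norm_smul, Real.norm_of_nonneg (by positivity)]
  have hint := intervalIntegral.norm_integral_le_of_norm_le (μ := volume) Real.two_pi_pos.le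
    (Filter.Eventually.of_forall fun θ _ ↦ pointwise (circleMap 0 r θ) (by simp [abs_of_pos hr0]))
    (by simpa only [circleMap_zero] using (hcont.const_mul _).intervalIntegrable _ _)
  rw [intervalIntegral.integral_const_mul] at hint
  simp only [circleMap_zero] at hint ⊢
  refine (mul_le_mul_of_nonneg_left hint (by positivity)).trans_eq ?_
  rw [← mul_assoc]
  congr 1
  field_simp
end

section
/- Let ε ∈ (0, 1/3), R₀ > 0, and let v : ℂ → ℝ be a nonnegative integrable function with support contained in the closed disk {w : |w| ≤ R₀}. Then there exists N ∈ ℕ such that for every n ≥ N, every monic polynomial p of degree n over ℂ all of whose roots lie in the closed disk {w : |w| ≤ R₀}, and every entire function g : ℂ → ℂ with ∫_ℂ |p(z)g(z)|² e^{-|z|²} dm(z) < ∞, one has ∫_ℂ |p(z)g(z)|² v(z) e^{-|z|²} dm(z) ≤ (∫_ℂ |p(z)|² v(z) dm(z)) · (1−ε)^{-2n} · (1/n!) · ∫_ℂ |p(z)g(z)|² e^{-|z|²} dm(z). -/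
open MeasureTheory

/-- A monic polynomial whose roots lie in the disk of radius `R` is at least `(‖z‖ - R) ^ deg`
outside that disk. -/
theorem Polynomial.Monic.sub_pow_natDegree_le_norm_eval {p : Polynomial ℂ} (hp : p.Monic) {R : ℝ}
    (hroots : ∀ w ∈ p.roots, ‖w‖ ≤ R) {z : ℂ} (hz : R ≤ ‖z‖) :
    (‖z‖ - R) ^ p.natDegree ≤ ‖p.eval z‖ := by
  have hs := IsAlgClosed.splits p
  rw [hs.eval_eq_prod_roots_of_monic hp, hs.natDegree_eq_card_roots]
  generalize p.roots = s at hroots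
  induction s using Multiset.induction_on with
  | empty => simp
  | cons a s ih =>
    have ha : ‖z‖ - R ≤ ‖z - a‖ := by
      linarith [norm_sub_norm_le z a, hroots a (Multiset.mem_cons_self a s)]
    rw [Multiset.card_cons, pow_succ', Multiset.map_cons, Multiset.prod_cons, norm_mul]
    exact mul_le_mul ha (ih fun w hw => hroots w (Multiset.mem_cons_of_mem hw))
      (pow_nonneg (sub_nonneg.2 hz) _) (norm_nonneg _)

/-- Cauchy's formula bounds an entire function inside a circle by its mean over that circle. -/
theorem Differentiable.two_pi_mul_norm_le_integral_circleMap {f : ℂ → ℂ} (hf : Differentiable ℂ f)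
    {w : ℂ} {ρ r : ℝ} (hw : ‖w‖ ≤ ρ) (hr : ρ < r) :
    2 * Real.pi * ((r - ρ) * ‖f w‖) ≤
      r * ∫ θ in (-Real.pi)..Real.pi, ‖f (circleMap 0 r θ)‖ := by
  have hr0 : 0 < r := ((norm_nonneg w).trans hw).trans_lt hr
  have hcauchy := hf.differentiableOn.circleIntegral_sub_inv_smul (R := r) (c := 0) (w := w)
    (by simpa using hw.trans_lt hr)
  have hcont : Continuous fun θ => ‖f (circleMap 0 r θ)‖ :=
    (hf.continuous.comp (continuous_circleMap 0 r)).norm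
  have hper : ∫ θ in (-Real.pi)..Real.pi, ‖f (circleMap 0 r θ)‖ =
      ∫ θ in (0 : ℝ)..2 * Real.pi, ‖f (circleMap 0 r θ)‖ := by
    have h : Function.Periodic (fun θ => ‖f (circleMap 0 r θ)‖) (2 * Real.pi) :=
      fun θ => by simp [periodic_circleMap 0 r θ]
    have := h.intervalIntegral_add_eq (-Real.pi) 0
    rwa [zero_add, show -Real.pi + 2 * Real.pi = Real.pi by ring] at this
  have hbound : ‖∮ z in C(0, r), (z - w)⁻¹ • f z‖ ≤
      ∫ θ in (0 : ℝ)..2 * Real.pi, r * (r - ρ)⁻¹ * ‖f (circleMap 0 r θ)‖ := by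
    refine intervalIntegral.norm_integral_le_of_norm_le Real.two_pi_pos.le
      (Filter.Eventually.of_forall fun θ _ => ?_) ((hcont.const_mul _).intervalIntegrable _ _)
    have hdist : r - ρ ≤ ‖circleMap 0 r θ - w‖ := by
      have := norm_sub_norm_le (circleMap 0 r θ) w
      rw [norm_circleMap_zero, abs_of_pos hr0] at this
      linarith
    have hinv := inv_anti₀ (sub_pos.2 hr) hdist
    simp only [deriv_circleMap, norm_smul, norm_mul, norm_circleMap_zero, abs_of_pos hr0,
      Complex.norm_I, mul_one, norm_inv, ← mul_assoc]
    gcongr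
  rw [hcauchy, intervalIntegral.integral_const_mul, ← hper, norm_smul] at hbound
  have hnorm : ‖(2 * Real.pi * Complex.I : ℂ)‖ = 2 * Real.pi := by
    simp [abs_of_pos Real.pi_pos]
  rw [hnorm] at hbound
  have hpos := sub_pos.2 hr
  calc 2 * Real.pi * ((r - ρ) * ‖f w‖) = (r - ρ) * (2 * Real.pi * ‖f w‖) := by ring
    _ ≤ (r - ρ) * (r * (r - ρ)⁻¹ * ∫ θ in (-Real.pi)..Real.pi, ‖f (circleMap 0 r θ)‖) := by
      gcongr
    _ = _ := by field_simp

theorem integrableOn_pow_mul_exp_neg_sq (n : ℕ) :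
    IntegrableOn (fun r : ℝ => r ^ n * Real.exp (-r ^ 2)) (Set.Ioi 0) := by
  have h := integrableOn_rpow_mul_exp_neg_rpow (p := 2) (s := n)
    (by linarith [(Nat.cast_nonneg n : (0 : ℝ) ≤ n)]) two_pos
  simpa using h

theorem integral_pow_mul_exp_neg_sq (n : ℕ) :
    ∫ r in Set.Ioi (0 : ℝ), r ^ (2 * n + 1) * Real.exp (-r ^ 2) = n.factorial / 2 := by
  have h := integral_rpow_mul_exp_neg_rpow (p := 2) (q := (2 * n + 1 : ℕ)) two_pos
    (by linarith [(Nat.cast_nonneg (2 * n + 1) : (0 : ℝ) ≤ (2 * n + 1 : ℕ))])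
  rw [show (((2 * n + 1 : ℕ) : ℝ) + 1) / 2 = n + 1 by push_cast; ring,
    Real.Gamma_nat_eq_factorial] at h
  simp only [Real.rpow_natCast, Real.rpow_ofNat] at h
  rw [h]; ring

theorem factorial_half_sub_le_integral_Ioi_pow_mul_exp_neg_sq (n : ℕ) {R : ℝ} (hR : 0 ≤ R) :
    n.factorial / 2 - R * R ^ (2 * n + 1) ≤
      ∫ r in Set.Ioi R, r ^ (2 * n + 1) * Real.exp (-r ^ 2) := by
  have hint := integrableOn_pow_mul_exp_neg_sq (2 * n + 1)
  have hsplit := setIntegral_union (Set.Ioc_disjoint_Ioi_same (a := (0 : ℝ)) (b := R))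
    measurableSet_Ioi (hint.mono_set Set.Ioc_subset_Ioi_self)
    (hint.mono_set (Set.Ioi_subset_Ioi hR))
  rw [Set.Ioc_union_Ioi_eq_Ioi hR, integral_pow_mul_exp_neg_sq] at hsplit
  have hsmall := norm_setIntegral_le_of_norm_le_const (μ := volume) (s := Set.Ioc 0 R)
    (f := fun r : ℝ => r ^ (2 * n + 1) * Real.exp (-r ^ 2)) (C := R ^ (2 * n + 1)) (by simp)
    fun r hr => by
      have hr0 := hr.1.le
      rw [Real.norm_of_nonneg (by positivity)]
      calc r ^ (2 * n + 1) * Real.exp (-r ^ 2) ≤ R ^ (2 * n + 1) * 1 := by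
            gcongr
            · exact hr.2
            · exact Real.exp_le_one_iff.2 (neg_nonpos.2 (sq_nonneg r))
        _ = _ := mul_one _
  have := (Real.le_norm_self _).trans hsmall
  rw [Real.volume_real_Ioc_of_le hR, sub_zero] at this
  linarith

/-- Integration in polar coordinates: a radial lower bound for the circular means of a nonnegative
function outside a disk yields a lower bound for its integral. -/
theorem setIntegral_Ioi_le_integral_of_le_circle_integral {F : ℂ → ℝ} (hF : Continuous F)
    (hF0 : ∀ z, 0 ≤ F z) (hFi : Integrable F) {R : ℝ} (hR : 0 ≤ R) {h : ℝ → ℝ}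
    (hh0 : ∀ r, R < r → 0 ≤ h r) (hhi : IntegrableOn h (Set.Ioi R))
    (hle : ∀ r, R < r → h r ≤ r * ∫ θ in (-Real.pi)..Real.pi, F (circleMap 0 r θ)) :
    ∫ r in Set.Ioi R, h r ≤ ∫ z, F z := by
  rw [← ENNReal.ofReal_le_ofReal_iff (integral_nonneg hF0),
    ofReal_integral_eq_lintegral_ofReal hhi
      ((ae_restrict_mem measurableSet_Ioi).mono fun r hr => hh0 r hr),
    ofReal_integral_eq_lintegral_ofReal hFi (.of_forall hF0),
    ← Complex.lintegral_comp_polarCoord_symm, polarCoord_target, Measure.volume_eq_prod,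
    ← Measure.prod_restrict]
  have hmap : ∀ r θ : ℝ, Complex.polarCoord.symm (r, θ) = circleMap 0 r θ := fun r θ => by
    simp [circleMap, Complex.exp_mul_I]
  have hmeas : Measurable fun q : ℝ × ℝ =>
      ENNReal.ofReal q.1 • ENNReal.ofReal (F (Complex.polarCoord.symm q)) := by
    simp only [Complex.polarCoord_symm_apply, smul_eq_mul]
    have : Continuous fun q : ℝ × ℝ => F (q.1 * (Real.cos q.2 + Real.sin q.2 * Complex.I)) := by
      fun_prop
    exact (ENNReal.measurable_ofReal.comp measurable_fst).mul
      (ENNReal.measurable_ofReal.comp this.measurable)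
  rw [lintegral_prod _ hmeas.aemeasurable]
  refine (setLIntegral_mono' measurableSet_Ioi fun r hr => ?_).trans
    (lintegral_mono_set (Set.Ioi_subset_Ioi hR))
  have hr0 : 0 ≤ r := hR.trans (le_of_lt hr)
  have hcont : Continuous fun θ => F (circleMap 0 r θ) := hF.comp (continuous_circleMap 0 r)
  simp only [hmap, smul_eq_mul]
  rw [lintegral_const_mul _ hcont.measurable.ennreal_ofReal,
    ← ofReal_integral_eq_lintegral_ofReal
      ((hcont.integrableOn_Icc).mono_set Set.Ioo_subset_Icc_self)
      (.of_forall fun θ => hF0 _), ← ENNReal.ofReal_mul hr0, ← integral_Ioc_eq_integral_Ioo,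
    ← intervalIntegral.integral_of_le (by linarith [Real.pi_pos])]
  exact ENNReal.ofReal_le_ofReal (hle r hr)

/-- Pointwise estimate of an entire function by the Fock norm of its product with a monic
polynomial whose zeros are confined to a disk. -/
theorem norm_sq_mul_le_integral_norm_eval_mul_sq {ε R : ℝ} (hε : ε ∈ Set.Ioo (0 : ℝ) 1)
    (hR : 0 < R) {p : Polynomial ℂ} (hp : p.Monic) (hroots : ∀ w ∈ p.roots, ‖w‖ ≤ R)
    {g : ℂ → ℂ} (hg : Differentiable ℂ g)
    (hint : Integrable fun z : ℂ => ‖p.eval z * g z‖ ^ 2 * Real.exp (-‖z‖ ^ 2))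
    {w : ℂ} (hw : ‖w‖ ≤ R) :
    2 * Real.pi * (1 - ε) * (1 - ε) ^ (2 * p.natDegree) * ‖g w‖ ^ 2 *
        (∫ r in Set.Ioi (R / ε), r ^ (2 * p.natDegree + 1) * Real.exp (-r ^ 2)) ≤
      ∫ z : ℂ, ‖p.eval z * g z‖ ^ 2 * Real.exp (-‖z‖ ^ 2) := by
  obtain ⟨hε0, hε1⟩ := hε
  have hρ : 0 < R / ε := div_pos hR hε0
  have h1 : 0 < 1 - ε := sub_pos.2 hε1
  have hpi := Real.pi_pos
  rw [← integral_const_mul]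
  refine setIntegral_Ioi_le_integral_of_le_circle_integral ?_ (fun z => by positivity) hint hρ.le
    (fun r hr => ?_) ?_ fun r hr => ?_
  · have := hg.continuous
    fun_prop
  · have := hρ.trans hr
    positivity
  · exact ((integrableOn_pow_mul_exp_neg_sq _).mono_set (Set.Ioi_subset_Ioi hρ.le)).const_mul _
  have hr0 : 0 < r := hρ.trans hr
  have hRr : R < ε * r := by rwa [div_lt_iff₀' hε0] at hr
  have hRr' : R < r := hRr.trans (by nlinarith)
  have hmean := (hg.pow 2).two_pi_mul_norm_le_integral_circleMap hw hRr'
  simp only [Pi.pow_apply, norm_pow] at hmean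
  set M := ∫ θ in (-Real.pi)..Real.pi, ‖g (circleMap 0 r θ)‖ ^ 2 with hM
  have hmean' : 2 * Real.pi * (1 - ε) * ‖g w‖ ^ 2 ≤ M := by
    have : r * (2 * Real.pi * (1 - ε) * ‖g w‖ ^ 2) ≤ r * M := by
      refine le_trans ?_ hmean
      have : (1 - ε) * r ≤ r - R := by linarith
      calc r * (2 * Real.pi * (1 - ε) * ‖g w‖ ^ 2)
          = 2 * Real.pi * (((1 - ε) * r) * ‖g w‖ ^ 2) := by ring
        _ ≤ _ := by gcongr
    exact le_of_mul_le_mul_left this hr0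
  have hgc := hg.continuous
  have hlow : (1 - ε) ^ (2 * p.natDegree) * r ^ (2 * p.natDegree) * Real.exp (-r ^ 2) * M ≤
      ∫ θ in (-Real.pi)..Real.pi, ‖p.eval (circleMap 0 r θ) * g (circleMap 0 r θ)‖ ^ 2 *
        Real.exp (-‖circleMap 0 r θ‖ ^ 2) := by
    rw [hM, ← intervalIntegral.integral_const_mul]
    refine intervalIntegral.integral_mono_on (by linarith)
      (Continuous.intervalIntegrable (by fun_prop) _ _)
      (Continuous.intervalIntegrable (by fun_prop) _ _) fun θ _ => ?_
    have hnorm : ‖circleMap 0 r θ‖ = r := by rw [norm_circleMap_zero, abs_of_pos hr0]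
    have hpz := hp.sub_pow_natDegree_le_norm_eval hroots (z := circleMap 0 r θ)
      (by rw [hnorm]; exact hRr'.le)
    rw [hnorm] at hpz
    have hpz' : ((1 - ε) * r) ^ p.natDegree ≤ ‖p.eval (circleMap 0 r θ)‖ :=
      (pow_le_pow_left₀ (by positivity) (by linarith) _).trans hpz
    rw [hnorm, norm_mul]
    calc (1 - ε) ^ (2 * p.natDegree) * r ^ (2 * p.natDegree) * Real.exp (-r ^ 2) *
          ‖g (circleMap 0 r θ)‖ ^ 2
        = (((1 - ε) * r) ^ p.natDegree * ‖g (circleMap 0 r θ)‖) ^ 2 * Real.exp (-r ^ 2) := by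
          rw [mul_pow (1 - ε) r]; ring
      _ ≤ _ := by gcongr
  calc _ = r * ((1 - ε) ^ (2 * p.natDegree) * r ^ (2 * p.natDegree) * Real.exp (-r ^ 2) *
        (2 * Real.pi * (1 - ε) * ‖g w‖ ^ 2)) := by ring
    _ ≤ _ := by
      gcongr
      exact (mul_le_mul_of_nonneg_left hmean' (by positivity)).trans hlow

theorem fock_embedding_upper_estimate (ε R₀ : ℝ) (hε : ε ∈ Set.Ioo (0:ℝ) (1/3))
    (hR₀ : 0 < R₀) (v : ℂ → ℝ) (hv : ∀ z, 0 ≤ v z) (hvi : Integrable v)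
    (hsupp : Function.support v ⊆ Metric.closedBall 0 R₀) :
    ∃ N : ℕ, ∀ n ≥ N, ∀ p : Polynomial ℂ, p.Monic → p.natDegree = n →
      (∀ w ∈ p.roots, ‖w‖ ≤ R₀) →
      ∀ g : ℂ → ℂ, Differentiable ℂ g →
        Integrable (fun z : ℂ =>
          ‖p.eval z * g z‖ ^ 2 * Real.exp (-‖z‖ ^ 2)) →
        (∫ z : ℂ, ‖p.eval z * g z‖ ^ 2 * v z * Real.exp (-‖z‖ ^ 2))
          ≤ (∫ z : ℂ, ‖p.eval z‖ ^ 2 * v z) *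
            (((1 - ε) ^ (2 * n))⁻¹ * ((Nat.factorial n : ℝ))⁻¹ *
              ∫ z : ℂ, ‖p.eval z * g z‖ ^ 2 * Real.exp (-‖z‖ ^ 2)) := by
  obtain ⟨hε0, hε1⟩ := hε
  have hρ : 0 < R₀ / ε := div_pos hR₀ hε0
  have h1 : 2 / 3 < 1 - ε := by linarith
  have hlim := (FloorSemiring.tendsto_pow_div_factorial_atTop ((R₀ / ε) ^ 2)).const_mul
    ((R₀ / ε) ^ 2)
  rw [mul_zero] at hlim
  obtain ⟨N, hN⟩ := Filter.eventually_atTop.1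
    (hlim.eventually (gt_mem_nhds (show (0 : ℝ) < 1 / 100 by norm_num)))
  refine ⟨N, fun n hn p hp hpn hroots g hg hint => ?_⟩
  have hfac : (0 : ℝ) < n.factorial := by positivity
  have hsmall : R₀ / ε * (R₀ / ε) ^ (2 * n + 1) ≤ n.factorial / 100 := by
    have := hN n hn
    rw [← mul_div_assoc, div_lt_iff₀ hfac] at this
    calc R₀ / ε * (R₀ / ε) ^ (2 * n + 1) = (R₀ / ε) ^ 2 * ((R₀ / ε) ^ 2) ^ n := by ring
      _ ≤ _ := by linarith
  have htail := factorial_half_sub_le_integral_Ioi_pow_mul_exp_neg_sq n hρ.le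
  set J := ∫ r in Set.Ioi (R₀ / ε), r ^ (2 * n + 1) * Real.exp (-r ^ 2)
  set I := ∫ z : ℂ, ‖p.eval z * g z‖ ^ 2 * Real.exp (-‖z‖ ^ 2)
  have hconst : (n.factorial : ℝ) ≤ 2 * Real.pi * (1 - ε) * J := by
    have hJ : (49 / 100 : ℝ) * n.factorial ≤ J := by linarith
    calc (n.factorial : ℝ) ≤ 2 * 3.14 * (2 / 3) * (49 / 100 * n.factorial) := by linarith
      _ ≤ _ := by gcongr; exact Real.pi_gt_d2.le
  have hpoint : ∀ w : ℂ, ‖w‖ ≤ R₀ →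
      ‖g w‖ ^ 2 ≤ ((1 - ε) ^ (2 * n))⁻¹ * (n.factorial : ℝ)⁻¹ * I := fun w hw => by
    have h := norm_sq_mul_le_integral_norm_eval_mul_sq ⟨hε0, by linarith⟩ hR₀ hp hroots hg hint hw
    rw [hpn] at h
    have hpow : 0 < (1 - ε) ^ (2 * n) := pow_pos (by linarith) _
    rw [← mul_inv, ← div_eq_inv_mul, le_div_iff₀ (by positivity)]
    calc ‖g w‖ ^ 2 * ((1 - ε) ^ (2 * n) * n.factorial)
        ≤ ‖g w‖ ^ 2 * ((1 - ε) ^ (2 * n) * (2 * Real.pi * (1 - ε) * J)) := by gcongr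
      _ = 2 * Real.pi * (1 - ε) * (1 - ε) ^ (2 * n) * ‖g w‖ ^ 2 * J := by ring
      _ ≤ I := h
  rw [← integral_mul_const]
  refine integral_mono_of_nonneg (.of_forall fun z => ?_) (Integrable.mul_const ?_ _)
    (.of_forall fun z => ?_)
  · have := hv z
    positivity
  · refine (integrableOn_iff_integrable_of_support_subset
      ((Function.support_mul_subset_right _ _).trans hsupp)).1 ?_
    exact hvi.integrableOn.continuousOn_mul (by fun_prop) (isCompact_closedBall _ _)
  · by_cases hz : v z = 0
    · simp [hz]
    have hw : ‖z‖ ≤ R₀ := by simpa using hsupp hz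
    have hvz := hv z
    have hexp : Real.exp (-‖z‖ ^ 2) ≤ 1 := Real.exp_le_one_iff.2 (neg_nonpos.2 (sq_nonneg _))
    calc ‖p.eval z * g z‖ ^ 2 * v z * Real.exp (-‖z‖ ^ 2)
        ≤ ‖p.eval z * g z‖ ^ 2 * v z * 1 := by gcongr
      _ = ‖p.eval z‖ ^ 2 * v z * ‖g z‖ ^ 2 := by rw [norm_mul]; ring
      _ ≤ _ := mul_le_mul_of_nonneg_left (hpoint z hw) (by positivity)
end

section
/- Let R₀ > 0 and let w ∈ ℂ with |w| > R₀. Then: (i) for every z ∈ ℂ with |z| ≤ R₀ one has |w|·|z − R₀²/w̄| ≤ R₀·|z − w|; and (ii) for every z ∈ ℂ with |z| ≥ R₀ one has |w|·|z − R₀²/w̄| ≥ R₀·|z − w|. -/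
/-- Reflecting a root `w ≠ 0` in the circle of radius `R` turns the factor `z - w` into
`z - R ^ 2 / conj w`; up to scaling, the squared moduli differ by
`(‖w‖ ^ 2 - R ^ 2) * (‖z‖ ^ 2 - R ^ 2)`. -/
lemma sq_norm_mul_norm_sub_reflection (R : ℝ) {w : ℂ} (hw : w ≠ 0) (z : ℂ) :
    (‖w‖ * ‖z - (R : ℂ) ^ 2 / (starRingEnd ℂ) w‖) ^ 2 =
      (R * ‖z - w‖) ^ 2 + (‖w‖ ^ 2 - R ^ 2) * (‖z‖ ^ 2 - R ^ 2) := by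
  have hconj : (starRingEnd ℂ) w ≠ 0 := (map_ne_zero _).mpr hw
  have hfactor : ‖w‖ * ‖z - (R : ℂ) ^ 2 / (starRingEnd ℂ) w‖ =
      ‖(starRingEnd ℂ) w * z - ((R ^ 2 : ℝ) : ℂ)‖ := by
    rw [← Complex.norm_conj w, ← norm_mul, mul_sub, mul_div_cancel₀ _ hconj, Complex.ofReal_pow]
  rw [hfactor, mul_pow]
  simp only [Complex.sq_norm, Complex.normSq_apply, Complex.sub_re, Complex.sub_im,
    Complex.mul_re, Complex.mul_im, Complex.conj_re, Complex.conj_im, Complex.ofReal_re,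
    Complex.ofReal_im]
  ring

theorem root_reflection_inequalities (R₀ : ℝ) (hR₀ : 0 < R₀) (w : ℂ)
    (hw : R₀ < ‖w‖) :
    (∀ z : ℂ, ‖z‖ ≤ R₀ →
      ‖w‖ * ‖z - (R₀ : ℂ) ^ 2 / (starRingEnd ℂ) w‖
        ≤ R₀ * ‖z - w‖) ∧
    (∀ z : ℂ, R₀ ≤ ‖z‖ →
      R₀ * ‖z - w‖
        ≤ ‖w‖ * ‖z - (R₀ : ℂ) ^ 2 / (starRingEnd ℂ) w‖) := by
  have hw0 : w ≠ 0 := norm_pos_iff.mp (hR₀.trans hw)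
  have hwR : 0 ≤ ‖w‖ ^ 2 - R₀ ^ 2 := sub_nonneg.mpr (by gcongr)
  refine ⟨fun z hz => ?_, fun z hz => ?_⟩
  · have hzR : ‖z‖ ^ 2 - R₀ ^ 2 ≤ 0 := sub_nonpos.mpr (by gcongr)
    refine le_of_sq_le_sq ?_ (by positivity)
    rw [sq_norm_mul_norm_sub_reflection R₀ hw0 z]
    linarith [mul_nonpos_of_nonneg_of_nonpos hwR hzR]
  · have hzR : 0 ≤ ‖z‖ ^ 2 - R₀ ^ 2 := sub_nonneg.mpr (by gcongr)
    refine le_of_sq_le_sq ?_ (by positivity)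
    rw [sq_norm_mul_norm_sub_reflection R₀ hw0 z]
    linarith [mul_nonneg hwR hzR]
end

section
/- Let R₀ > 0, R ≥ R₀, n ∈ ℕ, and let v : ℂ → ℝ be a nonnegative integrable function with support contained in the closed disk {w : |w| ≤ R₀}. Let q be a nonzero polynomial over ℂ of degree at most n with ∫_{|z| ≥ R} |q(z)|² e^{-|z|²} dm(z) > 0. Then there exists a polynomial q̃ over ℂ with deg q̃ = deg q, all roots of q̃ lying in the closed disk {w : |w| ≤ R₀}, and (∫_ℂ |q̃(z)|² v(z) e^{-|z|²} dm(z)) / (∫_{|z|≥R} |q̃(z)|² e^{-|z|²} dm(z)) ≤ (∫_ℂ |q(z)|² v(z) e^{-|z|²} dm(z)) / (∫_{|z|≥R} |q(z)|² e^{-|z|²} dm(z)). -/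
open MeasureTheory

lemma norm_sq_conj_mul_sub_sub (z w : ℂ) (r : ℝ) :
    ‖(starRingEnd ℂ) w * z - (r : ℂ) ^ 2‖ ^ 2 - r ^ 2 * ‖z - w‖ ^ 2
      = (‖z‖ ^ 2 - r ^ 2) * (‖w‖ ^ 2 - r ^ 2) := by
  simp only [← Complex.normSq_eq_norm_sq]
  simp only [Complex.normSq_apply, pow_two, Complex.sub_re,
    Complex.sub_im, Complex.mul_re, Complex.mul_im, Complex.conj_re, Complex.conj_im,
    Complex.ofReal_re, Complex.ofReal_im]
  ring

/-- A linear factor can be reflected into the disk of radius `r`, decreasing its modulus on the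
disk and increasing it outside. -/
lemma exists_reflected_linear_factor {r : ℝ} (hr : 0 < r) (w : ℂ) :
    ∃ f : Polynomial ℂ, f ≠ 0 ∧ f.natDegree = 1 ∧ (∀ u ∈ f.roots, ‖u‖ ≤ r) ∧
      (∀ z, ‖z‖ ≤ r → ‖f.eval z‖ ≤ ‖z - w‖) ∧ (∀ z, r ≤ ‖z‖ → ‖z - w‖ ≤ ‖f.eval z‖) := by
  rcases le_or_gt ‖w‖ r with hw | hw
  · exact ⟨Polynomial.X - Polynomial.C w, Polynomial.X_sub_C_ne_zero w, Polynomial.natDegree_X_sub_C w,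
      by simpa using hw, by simp, by simp⟩
  have hr' : (r : ℂ) ≠ 0 := by exact_mod_cast hr.ne'
  have hwn : 0 < ‖w‖ := hr.trans hw
  have hw0 : (starRingEnd ℂ) w ≠ 0 := by simpa using norm_pos_iff.mp hwn
  have ha : (starRingEnd ℂ) w / r ≠ 0 := div_ne_zero hw0 hr'
  set f : Polynomial ℂ :=
    Polynomial.C ((starRingEnd ℂ) w / r) * Polynomial.X + Polynomial.C (-(r : ℂ)) with hf
  have hdeg : f.natDegree = 1 := Polynomial.natDegree_linear ha
  have heval (z : ℂ) : r * ‖f.eval z‖ = ‖(starRingEnd ℂ) w * z - (r : ℂ) ^ 2‖ := by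
    have : (starRingEnd ℂ) w * z - (r : ℂ) ^ 2 = r * f.eval z := by
      simp only [hf, Polynomial.eval_add, Polynomial.eval_mul, Polynomial.eval_C,
        Polynomial.eval_X]
      field_simp
      ring
    rw [this, norm_mul, Complex.norm_real, Real.norm_of_nonneg hr.le]
  have hid (z : ℂ) : r ^ 2 * (‖f.eval z‖ ^ 2 - ‖z - w‖ ^ 2)
      = (‖z‖ ^ 2 - r ^ 2) * (‖w‖ ^ 2 - r ^ 2) := by
    rw [← norm_sq_conj_mul_sub_sub, ← heval]
    ring
  have hw2 : 0 < ‖w‖ ^ 2 - r ^ 2 := by nlinarith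
  refine ⟨f, ?_, hdeg, fun u hu ↦ ?_, fun z hz ↦ ?_, fun z hz ↦ ?_⟩
  · rintro h
    simp [h] at hdeg
  · have hu0 := Polynomial.isRoot_of_mem_roots hu
    have h := heval u
    rw [hu0, norm_zero, mul_zero, eq_comm, norm_eq_zero, sub_eq_zero] at h
    have h := congrArg norm h
    rw [norm_mul, RCLike.norm_conj, norm_pow, Complex.norm_real, Real.norm_of_nonneg hr.le] at h
    by_contra! hc
    nlinarith
  · refine (sq_le_sq₀ (norm_nonneg _) (norm_nonneg _)).mp ?_
    have : ‖z‖ ^ 2 - r ^ 2 ≤ 0 := by nlinarith [norm_nonneg z]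
    have h2 := hid z ▸ mul_nonpos_of_nonpos_of_nonneg this hw2.le
    have := nonpos_of_mul_nonpos_right h2 (by positivity)
    linarith
  · refine (sq_le_sq₀ (norm_nonneg _) (norm_nonneg _)).mp ?_
    have : 0 ≤ ‖z‖ ^ 2 - r ^ 2 := by nlinarith [norm_nonneg z]
    have h2 := hid z ▸ mul_nonneg this hw2.le
    have := nonneg_of_mul_nonneg_right h2 (by positivity)
    linarith

lemma exists_reflected_multiset_prod {r : ℝ} (hr : 0 < r) (s : Multiset ℂ) :
    ∃ f : Polynomial ℂ, f ≠ 0 ∧ f.natDegree = s.card ∧ (∀ u ∈ f.roots, ‖u‖ ≤ r) ∧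
      (∀ z, ‖z‖ ≤ r → ‖f.eval z‖ ≤ ‖(s.map fun w ↦ z - w).prod‖) ∧
      (∀ z, r ≤ ‖z‖ → ‖(s.map fun w ↦ z - w).prod‖ ≤ ‖f.eval z‖) := by
  induction s using Multiset.induction with
  | empty => exact ⟨1, one_ne_zero, by simp, by simp, by simp, by simp⟩
  | cons w s ih =>
    obtain ⟨f, hf0, hfd, hfr, hfi, hfo⟩ := ih
    obtain ⟨g, hg0, hgd, hgr, hgi, hgo⟩ := exists_reflected_linear_factor hr w
    refine ⟨g * f, mul_ne_zero hg0 hf0, ?_, fun u hu ↦ ?_, fun z hz ↦ ?_, fun z hz ↦ ?_⟩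
    · rw [Polynomial.natDegree_mul hg0 hf0, hfd, hgd, Multiset.card_cons, add_comm]
    · rw [Polynomial.roots_mul (mul_ne_zero hg0 hf0), Multiset.mem_add] at hu
      exact hu.elim (hgr u) (hfr u)
    · rw [Multiset.map_cons, Multiset.prod_cons, Polynomial.eval_mul, norm_mul, norm_mul]
      exact mul_le_mul (hgi z hz) (hfi z hz) (norm_nonneg _) (norm_nonneg _)
    · rw [Multiset.map_cons, Multiset.prod_cons, Polynomial.eval_mul, norm_mul, norm_mul]
      exact mul_le_mul (hgo z hz) (hfo z hz) (norm_nonneg _) (norm_nonneg _)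

lemma exists_reflected_polynomial {r : ℝ} (hr : 0 < r) {q : Polynomial ℂ} (hq : q ≠ 0) :
    ∃ f : Polynomial ℂ, f.natDegree = q.natDegree ∧ (∀ u ∈ f.roots, ‖u‖ ≤ r) ∧
      (∀ z, ‖z‖ ≤ r → ‖f.eval z‖ ≤ ‖q.eval z‖) ∧ (∀ z, r ≤ ‖z‖ → ‖q.eval z‖ ≤ ‖f.eval z‖) := by
  have hl : q.leadingCoeff ≠ 0 := Polynomial.leadingCoeff_ne_zero.mpr hq
  have hsplit := IsAlgClosed.splits q
  have heval (z : ℂ) : ‖q.eval z‖ = ‖q.leadingCoeff‖ * ‖(q.roots.map fun w ↦ z - w).prod‖ := by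
    rw [← norm_mul, ← hsplit.eval_eq_prod_roots]
  obtain ⟨f, hf0, hfd, hfr, hfi, hfo⟩ := exists_reflected_multiset_prod hr q.roots
  refine ⟨Polynomial.C q.leadingCoeff * f, ?_, ?_, fun z hz ↦ ?_, fun z hz ↦ ?_⟩
  · rw [Polynomial.natDegree_C_mul hl, hfd, hsplit.natDegree_eq_card_roots]
  · rwa [Polynomial.roots_C_mul _ hl]
  · rw [heval, Polynomial.eval_mul, Polynomial.eval_C, norm_mul]
    gcongr
    exact hfi z hz
  · rw [heval, Polynomial.eval_mul, Polynomial.eval_C, norm_mul]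
    gcongr
    exact hfo z hz

lemma integrable_norm_pow_mul_exp_neg_sq (k : ℕ) :
    Integrable fun z : ℂ ↦ ‖z‖ ^ k * Real.exp (-‖z‖ ^ 2) := by
  have h := Complex.integral_rpow_mul_exp_neg_rpow (p := 2) (q := k) (by norm_num)
    (by linarith [k.cast_nonneg (α := ℝ)])
  refine .of_integral_ne_zero ?_
  simp only [Real.rpow_natCast, Real.rpow_ofNat] at h
  rw [h]
  have := Real.Gamma_pos_of_pos (s := ((k : ℝ) + 2) / 2) (by positivity)
  positivity

lemma integrable_norm_eval_sq_mul_exp_neg_sq (p : Polynomial ℂ) :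
    Integrable fun z : ℂ ↦ ‖p.eval z‖ ^ 2 * Real.exp (-‖z‖ ^ 2) := by
  induction p using Polynomial.induction_on' with
  | add p q hp hq =>
    refine ((hp.const_mul 2).add (hq.const_mul 2)).mono'
      (by fun_prop) (.of_forall fun z ↦ ?_)
    rw [Real.norm_of_nonneg (by positivity), Polynomial.eval_add]
    have h : ‖p.eval z + q.eval z‖ ^ 2 ≤ 2 * ‖p.eval z‖ ^ 2 + 2 * ‖q.eval z‖ ^ 2 := by
      nlinarith [norm_add_le (p.eval z) (q.eval z), norm_nonneg (p.eval z + q.eval z),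
        sq_nonneg (‖p.eval z‖ - ‖q.eval z‖)]
    calc _ ≤ (2 * ‖p.eval z‖ ^ 2 + 2 * ‖q.eval z‖ ^ 2) * Real.exp (-‖z‖ ^ 2) := by gcongr
      _ = _ := by simp only [Pi.add_apply]; ring
  | monomial n a =>
    convert (integrable_norm_pow_mul_exp_neg_sq (n * 2)).const_mul (‖a‖ ^ 2) using 2 with z
    rw [Polynomial.eval_monomial, norm_mul, norm_pow]
    ring

lemma integrable_norm_eval_sq_mul_mul_exp_neg_sq {v : ℂ → ℝ} (hv : Integrable v) {r : ℝ}
    (hsupp : Function.support v ⊆ Metric.closedBall 0 r) (p : Polynomial ℂ) :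
    Integrable fun z : ℂ ↦ ‖p.eval z‖ ^ 2 * v z * Real.exp (-‖z‖ ^ 2) := by
  have hcont : Continuous fun z : ℂ ↦ ‖p.eval z‖ ^ 2 * Real.exp (-‖z‖ ^ 2) := by fun_prop
  have h := hv.integrableOn.continuousOn_mul hcont.continuousOn
    (isCompact_closedBall (0 : ℂ) r)
  refine ((integrableOn_iff_integrable_of_support_subset
    ((Function.support_mul_subset_right _ _).trans hsupp)).mp h).congr (.of_forall fun z ↦ ?_)
  ring

theorem rayleigh_quotient_roots_in_disk (R₀ R : ℝ) (hR₀ : 0 < R₀) (hR : R₀ ≤ R)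
    (n : ℕ) (v : ℂ → ℝ) (hv : ∀ z, 0 ≤ v z) (hvi : Integrable v)
    (hsupp : Function.support v ⊆ Metric.closedBall 0 R₀)
    (q : Polynomial ℂ) (hq : q ≠ 0) (hdeg : q.natDegree ≤ n)
    (hpos : 0 < ∫ z in {z : ℂ | R ≤ ‖z‖},
        ‖q.eval z‖ ^ 2 * Real.exp (-‖z‖ ^ 2)) :
    ∃ qt : Polynomial ℂ, qt.natDegree = q.natDegree ∧
      (∀ w ∈ qt.roots, ‖w‖ ≤ R₀) ∧
      (∫ z : ℂ, ‖qt.eval z‖ ^ 2 * v z * Real.exp (-‖z‖ ^ 2)) /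
          (∫ z in {z : ℂ | R ≤ ‖z‖},
            ‖qt.eval z‖ ^ 2 * Real.exp (-‖z‖ ^ 2))
        ≤ (∫ z : ℂ, ‖q.eval z‖ ^ 2 * v z * Real.exp (-‖z‖ ^ 2)) /
          (∫ z in {z : ℂ | R ≤ ‖z‖},
            ‖q.eval z‖ ^ 2 * Real.exp (-‖z‖ ^ 2)) := by
  obtain ⟨f, hfd, hfr, hfi, hfo⟩ := exists_reflected_polynomial hR₀ hq
  refine ⟨f, hfd, hfr, div_le_div₀ ?_ ?_ hpos ?_⟩
  · exact integral_nonneg fun z ↦ mul_nonneg (mul_nonneg (by positivity) (hv z)) (by positivity)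
  · refine integral_mono (integrable_norm_eval_sq_mul_mul_exp_neg_sq hvi hsupp f)
      (integrable_norm_eval_sq_mul_mul_exp_neg_sq hvi hsupp q) fun z ↦ ?_
    by_cases hz : v z = 0
    · simp [hz]
    · have hz' : ‖z‖ ≤ R₀ := by simpa using hsupp hz
      have := hfi z hz'
      have := hv z
      dsimp only
      gcongr
  · refine setIntegral_mono_on (integrable_norm_eval_sq_mul_exp_neg_sq q).integrableOn
      (integrable_norm_eval_sq_mul_exp_neg_sq f).integrableOn
      (measurableSet_le measurable_const measurable_norm) fun z hz ↦ ?_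
    have := hfo z (hR.trans hz)
    gcongr
end

section
/- Let R₀ > 0, ε ∈ (0,1), set R = R₀/ε, and let v : ℂ → ℝ be a nonnegative integrable function with support contained in the closed disk {w : |w| ≤ R₀}. Then for every monic polynomial q of degree m over ℂ all of whose roots lie in the closed disk {w : |w| ≤ R₀} one has ∫_ℂ |q(z)|² v(z) e^{-|z|²} dm(z) ≥ (e^{-R₀²} M_m(v) / ((1+ε)^{2m} π m!)) · ∫_{|z| ≥ R} |q(z)|² e^{-|z|²} dm(z), where M_m(v) = inf{ ∫_ℂ |p(z)|² v(z) dm(z) : p a monic polynomial of degree m over ℂ }. -/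
open MeasureTheory

/-- `M_m(v)`: the infimum of `∫ |p|² v dm` over monic polynomials `p` of degree `m`. -/
noncomputable def M (v : ℂ → ℝ) (m : ℕ) : ℝ :=
  sInf {t : ℝ | ∃ p : Polynomial ℂ, p.Monic ∧ p.natDegree = m ∧
    t = ∫ z : ℂ, ‖p.eval z‖ ^ 2 * v z}

/-- A monic polynomial with roots in the disk of radius `r` is at most `(‖z‖ + r) ^ deg` at `z`. -/
theorem norm_eval_le_of_roots_norm_le {q : Polynomial ℂ} (hmonic : q.Monic) {r : ℝ}
    (hroots : ∀ w ∈ q.roots, ‖w‖ ≤ r) (z : ℂ) :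
    ‖q.eval z‖ ≤ (‖z‖ + r) ^ q.natDegree := by
  have hs := IsAlgClosed.splits q
  rw [hs.eval_eq_prod_roots_of_monic hmonic, hs.natDegree_eq_card_roots, ← coe_nnnorm,
    ← nnnormHom_apply, map_multiset_prod, Multiset.map_map, NNReal.coe_multiset_prod,
    Multiset.map_map, ← Multiset.prod_replicate, ← Multiset.map_const']
  refine Multiset.prod_map_le_prod_map₀ _ _ (fun w _ => NNReal.coe_nonneg _) fun w hw => ?_
  exact (norm_sub_le z w).trans (by gcongr; exact hroots w hw)

theorem Complex.integral_norm_pow_mul_exp_neg_norm_sq (m : ℕ) :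
    ∫ z : ℂ, ‖z‖ ^ (2 * m) * Real.exp (-‖z‖ ^ 2) = Real.pi * (m.factorial : ℝ) := by
  have h := Complex.integral_rpow_mul_exp_neg_rpow (p := 2) (q := ((2 * m : ℕ) : ℝ))
    one_le_two (by linarith [Nat.cast_nonneg (α := ℝ) (2 * m)])
  simp only [Real.rpow_natCast, Real.rpow_two] at h
  rw [h, ← Real.Gamma_nat_eq_factorial]
  push_cast
  rw [show (2 * (m : ℝ) + 2) / 2 = m + 1 by ring]
  ring

theorem Complex.integrable_norm_pow_mul_exp_neg_norm_sq (m : ℕ) :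
    Integrable fun z : ℂ => ‖z‖ ^ (2 * m) * Real.exp (-‖z‖ ^ 2) := by
  refine .of_integral_ne_zero ?_
  rw [Complex.integral_norm_pow_mul_exp_neg_norm_sq]
  positivity

/-- The Fock-type mass outside the disk of radius `R₀ / ε` of a monic polynomial with roots in the
disk of radius `R₀`. -/
theorem setIntegral_norm_eval_sq_mul_exp_le {R₀ ε : ℝ} (hR₀ : 0 ≤ R₀) (hε : 0 < ε)
    {q : Polynomial ℂ} (hmonic : q.Monic) (hroots : ∀ w ∈ q.roots, ‖w‖ ≤ R₀) :
    ∫ z in {z : ℂ | R₀ / ε ≤ ‖z‖}, ‖q.eval z‖ ^ 2 * Real.exp (-‖z‖ ^ 2) ≤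
      (1 + ε) ^ (2 * q.natDegree) * Real.pi * (q.natDegree.factorial : ℝ) := by
  set m := q.natDegree
  have hint := (Complex.integrable_norm_pow_mul_exp_neg_norm_sq m).const_mul ((1 + ε) ^ (2 * m))
  calc ∫ z in {z : ℂ | R₀ / ε ≤ ‖z‖}, ‖q.eval z‖ ^ 2 * Real.exp (-‖z‖ ^ 2)
      ≤ ∫ z in {z : ℂ | R₀ / ε ≤ ‖z‖},
          (1 + ε) ^ (2 * m) * (‖z‖ ^ (2 * m) * Real.exp (-‖z‖ ^ 2)) := by
        refine integral_mono_of_nonneg (.of_forall fun z => by positivity) hint.integrableOn ?_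
        refine ae_restrict_of_forall_mem
          (measurableSet_le measurable_const measurable_norm) fun z hz => ?_
        have hz' : R₀ ≤ ‖z‖ * ε := (div_le_iff₀ hε).1 hz
        have hq : ‖q.eval z‖ ≤ ((1 + ε) * ‖z‖) ^ m :=
          (norm_eval_le_of_roots_norm_le hmonic hroots z).trans
            (pow_le_pow_left₀ (by positivity) (by linarith) _)
        calc ‖q.eval z‖ ^ 2 * Real.exp (-‖z‖ ^ 2)
            ≤ (((1 + ε) * ‖z‖) ^ m) ^ 2 * Real.exp (-‖z‖ ^ 2) := by gcongr
          _ = _ := by rw [mul_pow]; ring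
    _ ≤ ∫ z : ℂ, (1 + ε) ^ (2 * m) * (‖z‖ ^ (2 * m) * Real.exp (-‖z‖ ^ 2)) :=
        setIntegral_le_integral hint (.of_forall fun z => by positivity)
    _ = _ := by
        rw [integral_const_mul, Complex.integral_norm_pow_mul_exp_neg_norm_sq, mul_assoc]

theorem M_nonneg {v : ℂ → ℝ} (hv : ∀ z, 0 ≤ v z) (m : ℕ) : 0 ≤ M v m := by
  refine Real.sInf_nonneg ?_
  rintro _ ⟨p, -, -, rfl⟩
  exact integral_nonneg fun z => mul_nonneg (by positivity) (hv z)

theorem M_le_integral {v : ℂ → ℝ} (hv : ∀ z, 0 ≤ v z) {p : Polynomial ℂ} (hp : p.Monic) :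
    M v p.natDegree ≤ ∫ z : ℂ, ‖p.eval z‖ ^ 2 * v z := by
  refine csInf_le ⟨0, ?_⟩ ⟨p, hp, rfl, rfl⟩
  rintro _ ⟨p, -, -, rfl⟩
  exact integral_nonneg fun z => mul_nonneg (by positivity) (hv z)

theorem MeasureTheory.Integrable.continuous_mul_of_support_subset {v g : ℂ → ℝ} {K : Set ℂ}
    (hvi : Integrable v) (hg : Continuous g) (hK : IsCompact K) (hsupp : Function.support v ⊆ K) :
    Integrable fun z => g z * v z := by
  rw [← integrableOn_iff_integrable_of_support_subset
    ((Function.support_mul_subset_right g v).trans hsupp)]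
  exact hvi.integrableOn.continuousOn_mul hg.continuousOn hK

theorem exp_mul_integral_le_integral_mul_exp {v : ℂ → ℝ} (hv : ∀ z, 0 ≤ v z) (hvi : Integrable v)
    {R₀ : ℝ} (hsupp : Function.support v ⊆ Metric.closedBall 0 R₀) (q : Polynomial ℂ) :
    Real.exp (-R₀ ^ 2) * ∫ z : ℂ, ‖q.eval z‖ ^ 2 * v z ≤
      ∫ z : ℂ, ‖q.eval z‖ ^ 2 * v z * Real.exp (-‖z‖ ^ 2) := by
  have hK : IsCompact (Metric.closedBall (0 : ℂ) R₀) := isCompact_closedBall 0 R₀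
  have hq : Continuous fun z : ℂ => ‖q.eval z‖ ^ 2 := by fun_prop
  rw [← integral_const_mul]
  refine integral_mono ((hvi.continuous_mul_of_support_subset hq hK hsupp).const_mul _) ?_
    fun z => ?_
  · refine (hvi.continuous_mul_of_support_subset (g := fun z : ℂ =>
      ‖q.eval z‖ ^ 2 * Real.exp (-‖z‖ ^ 2)) (by fun_prop) hK hsupp).congr
      (.of_forall fun z => ?_)
    ring
  · by_cases hz : v z = 0
    · simp [hz]
    have hz' : ‖z‖ ≤ R₀ := mem_closedBall_zero_iff.1 (hsupp hz)
    have := hv z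
    dsimp only
    rw [mul_comm]
    gcongr

theorem fock_embedding_lower_estimate (R₀ ε : ℝ) (hR₀ : 0 < R₀)
    (hε : ε ∈ Set.Ioo (0:ℝ) 1)
    (v : ℂ → ℝ) (hv : ∀ z, 0 ≤ v z) (hvi : Integrable v)
    (hsupp : Function.support v ⊆ Metric.closedBall 0 R₀)
    (m : ℕ) (q : Polynomial ℂ) (hmonic : q.Monic) (hdeg : q.natDegree = m)
    (hroots : ∀ w ∈ q.roots, ‖w‖ ≤ R₀) :
    (Real.exp (-R₀ ^ 2) * M v m / ((1 + ε) ^ (2 * m) * Real.pi * (Nat.factorial m : ℝ))) *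
        ∫ z in {z : ℂ | R₀ / ε ≤ ‖z‖},
          ‖q.eval z‖ ^ 2 * Real.exp (-‖z‖ ^ 2)
      ≤ ∫ z : ℂ, ‖q.eval z‖ ^ 2 * v z * Real.exp (-‖z‖ ^ 2) := by
  subst hdeg
  have hε₀ : 0 < ε := hε.1
  have hM := M_nonneg hv q.natDegree
  calc _ ≤ Real.exp (-R₀ ^ 2) * M v q.natDegree /
          ((1 + ε) ^ (2 * q.natDegree) * Real.pi * (q.natDegree.factorial : ℝ)) *
          ((1 + ε) ^ (2 * q.natDegree) * Real.pi * (q.natDegree.factorial : ℝ)) := by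
        gcongr
        exact setIntegral_norm_eval_sq_mul_exp_le hR₀.le hε₀ hmonic hroots
    _ = Real.exp (-R₀ ^ 2) * M v q.natDegree := div_mul_cancel₀ _ (by positivity)
    _ ≤ Real.exp (-R₀ ^ 2) * ∫ z : ℂ, ‖q.eval z‖ ^ 2 * v z := by
        gcongr
        exact M_le_integral hv hmonic
    _ ≤ _ := exp_mul_integral_le_integral_mul_exp hv hvi hsupp q
end

section
/- For every R > 0 there exists a constant C = C(R) > 0 such that for every entire function f : ℂ → ℂ with ∫_ℂ |f(z)|² e^{-|z|²} dm(z) < ∞ one has ∫_ℂ |f(z)|² e^{-|z|²} dm(z) ≤ C · ∫_{|z| ≥ R} |f(z)|² e^{-|z|²} dm(z). -/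
open MeasureTheory

open Real in
/-- Sub-mean value property over circles. -/
theorem Differentiable.two_pi_mul_enorm_le_lintegral_circleMap {f : ℂ → ℂ}
    (hf : Differentiable ℂ f) (c : ℂ) (r : ℝ) :
    ENNReal.ofReal (2 * π) * ‖f c‖ₑ ≤ ∫⁻ θ in Set.Ioo (-π) π, ‖f (circleMap c r θ)‖ₑ := by
  have key : ∫ θ in Set.Ioo (-π) π, f (circleMap c r θ) = (2 * π) • f c := by
    have hm := (hf.diffContOnCl (s := Metric.ball c |r|)).circleAverage
    have hp : Function.Periodic (fun θ => f (circleMap c r θ)) (2 * π) := fun θ => by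
      simp [periodic_circleMap c r θ]
    have hs := hp.intervalIntegral_add_eq (-π) 0
    rw [show -π + 2 * π = π by ring, zero_add] at hs
    rw [← hm, circleAverage_def, smul_inv_smul₀ (by positivity), ← integral_Ioc_eq_integral_Ioo,
      ← intervalIntegral.integral_of_le (by linarith [pi_pos]), hs]
  calc _ = ‖∫ θ in Set.Ioo (-π) π, f (circleMap c r θ)‖ₑ := by
        rw [key, enorm_smul, Real.enorm_of_nonneg (by positivity)]
    _ ≤ _ := enorm_integral_le_lintegral_enorm _

open Real in
/-- Sub-mean value property over discs. -/
theorem Differentiable.pi_mul_sq_mul_enorm_le_lintegral_ball {f : ℂ → ℂ}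
    (hf : Differentiable ℂ f) (c : ℂ) {ρ : ℝ} (hρ : 0 ≤ ρ) :
    ENNReal.ofReal (π * ρ ^ 2) * ‖f c‖ₑ ≤ ∫⁻ z in Metric.ball c ρ, ‖f z‖ₑ := by
  have hcont : Continuous f := hf.continuous
  have hradial : ∫⁻ r in Set.Ioo 0 ρ, ENNReal.ofReal r = ENNReal.ofReal (ρ ^ 2 / 2) := by
    rw [← ofReal_integral_eq_lintegral_ofReal, ← integral_Ioc_eq_integral_Ioo,
      ← intervalIntegral.integral_of_le hρ, integral_id]
    · simp
    · exact (continuous_id.integrableOn_Icc (a := 0) (b := ρ)).mono_set Set.Ioo_subset_Icc_self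
    · filter_upwards [ae_restrict_mem measurableSet_Ioo] with r hr using hr.1.le
  calc ENNReal.ofReal (π * ρ ^ 2) * ‖f c‖ₑ
      = ∫⁻ r in Set.Ioo 0 ρ, ENNReal.ofReal r * (ENNReal.ofReal (2 * π) * ‖f c‖ₑ) := by
        rw [lintegral_mul_const _ (by fun_prop), hradial, ← mul_assoc,
          ← ENNReal.ofReal_mul (by positivity)]
        congr 2
        ring
    _ ≤ ∫⁻ r in Set.Ioo 0 ρ, ∫⁻ θ in Set.Ioo (-π) π,
          ENNReal.ofReal r * ‖f (circleMap c r θ)‖ₑ := by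
        refine lintegral_mono fun r => ?_
        have hcircle : Continuous fun θ => f (circleMap c r θ) := by fun_prop
        rw [lintegral_const_mul _ hcircle.enorm.measurable]
        gcongr
        exact hf.two_pi_mul_enorm_le_lintegral_circleMap c r
    _ = ∫⁻ p in Set.Ioo 0 ρ ×ˢ Set.Ioo (-π) π,
          ENNReal.ofReal p.1 * ‖f (circleMap c p.1 p.2)‖ₑ := by
        rw [Measure.volume_eq_prod, setLIntegral_prod]
        unfold circleMap
        fun_prop
    _ = ∫⁻ p in Set.Ioo 0 ρ ×ˢ Set.Ioo (-π) π, ENNReal.ofReal p.1 •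
          (Metric.ball c ρ).indicator (fun z => ‖f z‖ₑ) (c + Complex.polarCoord.symm p) := by
        refine setLIntegral_congr_fun (measurableSet_Ioo.prod measurableSet_Ioo) fun p hp => ?_
        have hpolar : c + Complex.polarCoord.symm p = circleMap c p.1 p.2 := by
          simp [circleMap, Complex.exp_mul_I]
        have hmem : circleMap c p.1 p.2 ∈ Metric.ball c ρ := by
          simpa [dist_eq_norm, circleMap_sub_center, abs_of_pos hp.1.1] using hp.1.2
        simp only [hpolar, Set.indicator_of_mem hmem, smul_eq_mul]
    _ ≤ ∫⁻ p in polarCoord.target, ENNReal.ofReal p.1 •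
          (Metric.ball c ρ).indicator (fun z => ‖f z‖ₑ) (c + Complex.polarCoord.symm p) :=
        lintegral_mono_set (Set.prod_mono Set.Ioo_subset_Ioi_self subset_rfl)
    _ = ∫⁻ z in Metric.ball c ρ, ‖f z‖ₑ := by
        rw [Complex.lintegral_comp_polarCoord_symm
            (fun u => (Metric.ball c ρ).indicator (fun z => ‖f z‖ₑ) (c + u)),
          lintegral_add_left_eq_self, lintegral_indicator measurableSet_ball]

open Real in
/-- Sub-mean value property of `‖f‖ ^ 2` over discs. -/
theorem Differentiable.pi_mul_sq_mul_norm_sq_le_integral_ball {f : ℂ → ℂ}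
    (hf : Differentiable ℂ f) (c : ℂ) {ρ : ℝ} (hρ : 0 ≤ ρ) :
    π * ρ ^ 2 * ‖f c‖ ^ 2 ≤ ∫ z in Metric.ball c ρ, ‖f z‖ ^ 2 := by
  have hcont : Continuous f := hf.continuous
  have hint : IntegrableOn (fun z => ‖f z‖ ^ 2) (Metric.ball c ρ) :=
    ((hcont.norm.pow 2).continuousOn.integrableOn_compact (isCompact_closedBall c ρ)).mono_set
      Metric.ball_subset_closedBall
  have h := (hf.pow 2).pi_mul_sq_mul_enorm_le_lintegral_ball c hρ
  have henorm : ∀ z, ‖(f ^ 2) z‖ₑ = ENNReal.ofReal (‖f z‖ ^ 2) := fun z => by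
    rw [← ofReal_norm, Pi.pow_apply, norm_pow]
  simp only [henorm] at h
  rw [← ofReal_integral_eq_lintegral_ofReal hint (ae_of_all _ fun z => by positivity),
    ← ENNReal.ofReal_mul (by positivity)] at h
  exact (ENNReal.ofReal_le_ofReal_iff (integral_nonneg fun z => by positivity)).1 h

open Real in
/-- Pointwise bound inside a disc by the Gaussian-weighted square integral outside of it. -/
theorem Differentiable.norm_sq_le_integral_gaussian_compl_ball {f : ℂ → ℂ}
    (hf : Differentiable ℂ f) {R : ℝ} (hR : 0 < R)
    (hint : Integrable (fun z : ℂ => ‖f z‖ ^ 2 * Real.exp (-‖z‖ ^ 2))) {w : ℂ} (hw : ‖w‖ < R) :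
    ‖f w‖ ^ 2 ≤ Real.exp ((R + 2) ^ 2) / π *
      ∫ z in {z : ℂ | R ≤ ‖z‖}, ‖f z‖ ^ 2 * Real.exp (-‖z‖ ^ 2) := by
  have hcont : Continuous f := hf.continuous
  have hsphere : ∀ z ∈ frontier (Metric.ball (0 : ℂ) (R + 1)), ‖(f ^ 2) z‖ ≤
      Real.exp ((R + 2) ^ 2) / π * ∫ z in {z : ℂ | R ≤ ‖z‖}, ‖f z‖ ^ 2 * Real.exp (-‖z‖ ^ 2) := by
    intro z hz
    rw [frontier_ball _ (by positivity), mem_sphere_zero_iff_norm] at hz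
    have hsub : Metric.ball z 1 ⊆ {u : ℂ | R ≤ ‖u‖} := fun u hu => by
      have := norm_sub_norm_le z u
      rw [Metric.mem_ball, dist_comm, dist_eq_norm] at hu
      simp only [Set.mem_ofPred_eq]
      linarith
    have hbound : ∀ u ∈ Metric.ball z 1,
        ‖f u‖ ^ 2 ≤ Real.exp ((R + 2) ^ 2) * (‖f u‖ ^ 2 * Real.exp (-‖u‖ ^ 2)) := fun u hu => by
      have hle : ‖u‖ ≤ R + 2 := by
        have := norm_sub_norm_le u z
        rw [Metric.mem_ball, dist_eq_norm] at hu
        linarith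
      have hexp : 1 ≤ Real.exp ((R + 2) ^ 2) * Real.exp (-‖u‖ ^ 2) := by
        rw [← Real.exp_add]
        apply Real.one_le_exp
        nlinarith [norm_nonneg u]
      nlinarith [sq_nonneg ‖f u‖]
    have hmean := hf.pi_mul_sq_mul_norm_sq_le_integral_ball z zero_le_one
    have hcomp : ∫ u in Metric.ball z 1, ‖f u‖ ^ 2 ≤
        Real.exp ((R + 2) ^ 2) * ∫ u in {u : ℂ | R ≤ ‖u‖}, ‖f u‖ ^ 2 * Real.exp (-‖u‖ ^ 2) :=
      calc _ ≤ ∫ u in Metric.ball z 1, Real.exp ((R + 2) ^ 2) * (‖f u‖ ^ 2 * Real.exp (-‖u‖ ^ 2)) :=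
            setIntegral_mono_on
              (((hcont.norm.pow 2).continuousOn.integrableOn_compact
                (isCompact_closedBall z 1)).mono_set Metric.ball_subset_closedBall)
              (hint.const_mul _).integrableOn measurableSet_ball hbound
        _ = Real.exp ((R + 2) ^ 2) * ∫ u in Metric.ball z 1, ‖f u‖ ^ 2 * Real.exp (-‖u‖ ^ 2) :=
            integral_const_mul _ _
        _ ≤ _ := mul_le_mul_of_nonneg_left
            (setIntegral_mono_set hint.integrableOn (ae_of_all _ fun u => by positivity)
              hsub.eventuallyLE) (Real.exp_pos _).le
    rw [Pi.pow_apply, norm_pow, div_mul_eq_mul_div, le_div_iff₀ pi_pos]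
    linarith
  have hmax := Complex.norm_le_of_forall_mem_frontier_norm_le Metric.isBounded_ball
    (hf.pow 2).diffContOnCl hsphere (z := w)
    (subset_closure (mem_ball_zero_iff.2 (by linarith)))
  rwa [Pi.pow_apply, norm_pow] at hmax

theorem fock_space_equivalent_norm (R : ℝ) (hR : 0 < R) :
    ∃ C : ℝ, 0 < C ∧ ∀ f : ℂ → ℂ, Differentiable ℂ f →
      Integrable (fun z : ℂ => ‖f z‖ ^ 2 * Real.exp (-‖z‖ ^ 2)) →
      (∫ z : ℂ, ‖f z‖ ^ 2 * Real.exp (-‖z‖ ^ 2))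
        ≤ C * ∫ z in {z : ℂ | R ≤ ‖z‖},
            ‖f z‖ ^ 2 * Real.exp (-‖z‖ ^ 2) := by
  refine ⟨1 + Real.exp ((R + 2) ^ 2) / Real.pi * volume.real (Metric.ball (0 : ℂ) R),
    by positivity, fun f hf hint => ?_⟩
  have hcompl : (Metric.ball (0 : ℂ) R)ᶜ = {z : ℂ | R ≤ ‖z‖} := by
    ext z
    simp
  have hball := norm_setIntegral_le_of_norm_le_const (μ := volume)
    (f := fun z : ℂ => ‖f z‖ ^ 2 * Real.exp (-‖z‖ ^ 2))
    (C := Real.exp ((R + 2) ^ 2) / Real.pi *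
      ∫ z in {z : ℂ | R ≤ ‖z‖}, ‖f z‖ ^ 2 * Real.exp (-‖z‖ ^ 2))
    (measure_ball_lt_top (x := (0 : ℂ)) (r := R)) fun z hz => by
      rw [Real.norm_of_nonneg (by positivity)]
      refine le_trans (mul_le_of_le_one_right (by positivity) ?_)
        (hf.norm_sq_le_integral_gaussian_compl_ball hR hint (mem_ball_zero_iff.1 hz))
      exact Real.exp_le_one_iff.2 (neg_nonpos.2 (by positivity))
  rw [← integral_add_compl measurableSet_ball hint (s := Metric.ball (0 : ℂ) R), hcompl]
  linarith [(Real.le_norm_self _).trans hball]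
end

section
/- Let c ∈ ℂ, ρ > 0, let Ω ⊂ ℂ be the closed disk of radius ρ centered at c, and let γ > 0. Then there exists l ∈ ℕ such that for every n ∈ ℕ there is a ℂ-linear subspace V of the space of polynomials over ℂ of degree at most n with dim_ℂ V ≥ n + 1 − l and such that every p ∈ V satisfies ∫_Ω |p(z)|² dm(z) ≤ γ² ∫_Ω |p'(z)|² dm(z). -/
open MeasureTheory

open Polynomial in
/-- On the unit circle, a polynomial whose coefficients of index below `l` vanish satisfies
`l² · avg |g|² ≤ avg |g'|²`. -/
lemma sq_mul_circleAverage_le_circleAverage_derivative (l : ℕ) (g : ℂ[X])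
    (hg : ∀ k < l, g.coeff k = 0) :
    (l : ℝ) ^ 2 * Real.circleAverage (fun z ↦ ‖g.eval z‖ ^ 2) 0 1 ≤
      Real.circleAverage (fun z ↦ ‖(derivative g).eval z‖ ^ 2) 0 1 := by
  have hcoeff (k : ℕ) : (X * derivative g).coeff k = k * g.coeff k := by
    cases k with
    | zero => simp
    | succ k => rw [coeff_X_mul, coeff_derivative]; push_cast; ring
  have hderiv : Real.circleAverage (fun z ↦ ‖(derivative g).eval z‖ ^ 2) 0 1 =
      Real.circleAverage (fun z ↦ ‖(X * derivative g).eval z‖ ^ 2) 0 1 := by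
    refine Real.circleAverage_congr_sphere fun z hz ↦ ?_
    have hz : ‖z‖ = 1 := by simpa using hz
    simp [hz]
  have hsub : (X * derivative g).support ⊆ g.support := fun k hk ↦ by
    rw [mem_support_iff, hcoeff] at hk
    exact mem_support_iff.2 (right_ne_zero_of_mul hk)
  rw [hderiv, ← sum_sq_norm_coeff_eq_circleAverage, ← sum_sq_norm_coeff_eq_circleAverage,
    Finset.sum_subset hsub fun k _ hk ↦ by simp [notMem_support_iff.1 hk], Finset.mul_sum]
  refine Finset.sum_le_sum fun k hk ↦ ?_
  have hlk : l ≤ k := by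
    by_contra! h
    exact mem_support_iff.1 hk (hg k h)
  rw [hcoeff, norm_mul, mul_pow, Complex.norm_natCast]
  gcongr

open Polynomial in
/-- On the circle of center `c` and radius `r`, a polynomial divisible by `(X - c)ˡ` satisfies
`l² · avg |p|² ≤ r² · avg |p'|²`. -/
lemma sq_mul_circleAverage_le_of_dvd (l : ℕ) (p : ℂ[X]) (c : ℂ)
    (hp : (X - C c) ^ l ∣ p) (r : ℝ) :
    (l : ℝ) ^ 2 * Real.circleAverage (fun z ↦ ‖p.eval z‖ ^ 2) c r ≤
      r ^ 2 * Real.circleAverage (fun z ↦ ‖(derivative p).eval z‖ ^ 2) c r := by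
  have hscale (F : ℂ → ℝ) : Real.circleAverage F c r =
      Real.circleAverage (fun z ↦ F (r * z + c)) 0 1 := by
    simp [Real.circleAverage, circleMap, add_comm]
  obtain ⟨q, rfl⟩ := hp
  set p := (X - C c) ^ l * q with hp
  set g := p.comp (C (r : ℂ) * X + C c) with hg
  have hdvd : X ^ l ∣ g := by
    simp only [hg, hp, mul_comp, pow_comp, sub_comp, X_comp, C_comp, add_sub_cancel_right, mul_pow]
    exact (dvd_mul_left _ _).mul_right _
  have key := sq_mul_circleAverage_le_circleAverage_derivative l g (X_pow_dvd_iff.1 hdvd)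
  have heval (z : ℂ) : g.eval z = p.eval (r * z + c) := by simp [hg]
  have hderiv (z : ℂ) : ‖(derivative g).eval z‖ ^ 2 =
      r ^ 2 • ‖(derivative p).eval (r * z + c)‖ ^ 2 := by
    simp [hg, derivative_comp, mul_pow]
  simp only [heval, hderiv] at key
  rw [hscale, hscale]
  refine key.trans_eq ?_
  exact Real.circleAverage_fun_smul (a := r ^ 2)

/-- A continuous function with nonnegative averages over all circles of center `c` and radius at
most `ρ` has nonnegative integral over the disk. -/
lemma setIntegral_closedBall_nonneg_of_circleAverage_nonneg {F : ℂ → ℝ} (hF : Continuous F)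
    (c : ℂ) (ρ : ℝ) (h : ∀ r, 0 < r → r ≤ ρ → 0 ≤ Real.circleAverage F c r) :
    0 ≤ ∫ z in Metric.closedBall c ρ, F z := by
  have hpolar : ∫ z in Metric.closedBall c ρ, F z =
      ∫ x in Set.Ioc 0 ρ ×ˢ Set.Ioo (-Real.pi) Real.pi, x.1 * F (circleMap c x.1 x.2) := by
    rw [← integral_indicator Metric.isClosed_closedBall.measurableSet,
      ← integral_add_left_eq_self _ c, ← Complex.integral_comp_polarCoord_symm,
      ← integral_indicator (by measurability), ← integral_indicator (by measurability)]
    congr 1 with x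
    have hsymm : c + Complex.polarCoord.symm x = circleMap c x.1 x.2 := by
      simp [Complex.polarCoord_symm_apply, circleMap, Complex.exp_mul_I]
    have hball : circleMap c x.1 x.2 ∈ Metric.closedBall c ρ ↔ |x.1| ≤ ρ := by
      simp [circleMap, dist_eq_norm]
    simp only [Set.indicator, hsymm, hball, Set.mem_prod, Set.mem_Ioc, smul_eq_mul]
    by_cases hx : 0 < x.1
    · simp only [hx, abs_of_pos hx, true_and]
      split_ifs <;> simp_all
    · simp [hx]
  rw [hpolar, Measure.volume_eq_prod, setIntegral_prod]
  · refine setIntegral_nonneg measurableSet_Ioc fun r hr ↦ ?_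
    rw [integral_const_mul]
    refine mul_nonneg hr.1.le ?_
    have hr := h r hr.1 hr.2
    rw [Real.circleAverage_eq_integral_add (-Real.pi),
      intervalIntegral.integral_comp_add_right (fun θ ↦ F (circleMap c r θ)), zero_add,
      show 2 * Real.pi + -Real.pi = Real.pi by ring,
      intervalIntegral.integral_of_le (by linarith [Real.pi_pos]),
      integral_Ioc_eq_integral_Ioo] at hr
    exact nonneg_of_mul_nonneg_right hr (by positivity)
  · have hcont : Continuous fun x : ℝ × ℝ ↦ x.1 * F (circleMap c x.1 x.2) := by
      unfold circleMap
      fun_prop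
    exact (hcont.continuousOn.integrableOn_compact (isCompact_Icc.prod isCompact_Icc)).mono_set
      (Set.prod_mono Set.Ioc_subset_Icc_self Set.Ioo_subset_Icc_self)

open Polynomial in
theorem poincare_subspace_for_polynomials (c : ℂ) (ρ : ℝ) (hρ : 0 < ρ)
    (γ : ℝ) (hγ : 0 < γ) :
    ∃ l : ℕ, ∀ n : ℕ, ∃ V : Submodule ℂ (Polynomial ℂ),
      V ≤ Polynomial.degreeLE ℂ (n : ℕ) ∧
      n + 1 - l ≤ Module.finrank ℂ V ∧
      ∀ p ∈ V,
        (∫ z in Metric.closedBall c ρ, ‖p.eval z‖ ^ 2)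
          ≤ γ ^ 2 * ∫ z in Metric.closedBall c ρ,
              ‖(Polynomial.derivative p).eval z‖ ^ 2 := by
  obtain ⟨l, hl⟩ := exists_nat_gt (ρ / γ)
  have hl0 : (0 : ℝ) < l := (by positivity : 0 < ρ / γ).trans hl
  have hmonic : ((X - C c) ^ l).Monic := (monic_X_sub_C c).pow l
  refine ⟨l, fun n ↦ ⟨(degreeLT ℂ (n + 1 - l)).map (LinearMap.mulLeft ℂ ((X - C c) ^ l)),
    ?_, ?_, ?_⟩⟩
  · rintro _ ⟨q, hq, rfl⟩
    have hq := mem_degreeLT.1 hq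
    rw [mem_degreeLE, LinearMap.mulLeft_apply, ← natDegree_le_iff_degree_le]
    rcases eq_or_ne q 0 with rfl | hq0
    · simp
    rw [← natDegree_lt_iff_degree_lt hq0] at hq
    rw [hmonic.natDegree_mul' hq0, natDegree_pow, natDegree_X_sub_C]
    omega
  · have hinj : Function.Injective (LinearMap.mulLeft ℂ ((X - C c) ^ l)) :=
      fun _ _ h ↦ mul_left_cancel₀ hmonic.ne_zero h
    rw [← (Submodule.equivMapOfInjective _ hinj _).finrank_eq, (degreeLTEquiv ℂ _).finrank_eq,
      Module.finrank_fin_fun]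
  · rintro _ ⟨q, -, rfl⟩
    rw [LinearMap.mulLeft_apply]
    set p := (X - C c) ^ l * q
    have hint (f : ℂ[X]) : IntegrableOn (fun z ↦ ‖f.eval z‖ ^ 2) (Metric.closedBall c ρ) :=
      (by fun_prop : Continuous fun z ↦ ‖f.eval z‖ ^ 2).continuousOn.integrableOn_compact
        (isCompact_closedBall c ρ)
    rw [← sub_nonneg, ← integral_const_mul, ← integral_sub ((hint _).const_mul _) (hint _)]
    refine setIntegral_closedBall_nonneg_of_circleAverage_nonneg (by fun_prop) c ρ
      fun r hr hrρ ↦ ?_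
    have key := sq_mul_circleAverage_le_of_dvd l p c (dvd_mul_right _ _) r
    have hcirc (f : ℂ[X]) : CircleIntegrable (fun z ↦ ‖f.eval z‖ ^ 2) c r :=
      (by fun_prop : Continuous fun z ↦ ‖f.eval z‖ ^ 2).continuousOn.circleIntegrable hr.le
    simp only [← smul_eq_mul (γ ^ 2)]
    rw [Real.circleAverage_fun_sub (hcirc _).const_fun_smul (hcirc _), sub_nonneg,
      Real.circleAverage_fun_smul, smul_eq_mul]
    have hnonneg : 0 ≤ Real.circleAverage (fun z ↦ ‖(derivative p).eval z‖ ^ 2) c r :=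
      Real.circleAverage_nonneg_of_nonneg fun _ _ ↦ by positivity
    have hrl : r ≤ l * γ := hrρ.trans ((div_lt_iff₀ hγ).1 hl).le
    refine le_of_mul_le_mul_left (key.trans ?_) (pow_pos hl0 2)
    rw [← mul_assoc, ← mul_pow]
    gcongr
end
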